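/- Suppose the SC-LB value β* is attained by a tuple (g̃, c̃^1,…,c̃^L, {x̃^k, I^k, λ^k}_k) such that for every k ∈ {1,…,K} the coefficients satisfy λ^k_i > 0 for all i ∈ I^k (i.e., c̃^{g̃(k)} lies in the strict conic hull cone₊({a^{ki} : i ∈ I^k}) = {Σ_{i∈I^k} γ_i a^{ki} : γ_i > 0}) and the selected rows {a^{ki} : i ∈ I^k} are linearly independent (the nondegeneracy implicit in the paper's proof, which makes x̃^k the unique optimal solution of DMP_k(c̃^{g̃(k)})). Then β* = ρ*; i.e., the lower-bound formulation attains exactly the optimal value of the stability-driven clustering problem. -/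

import Mathlib

/- Proposition 2(ii) of the paper: exactness of the SC-LB value under strict conic combinations. -/

open scoped Matrix BigOperators

/-- Feasible set `{x : A x ≥ b}` of a linear program given by the rows `a i` of `A`. -/
def Feas {n m : ℕ} (a : Fin m → Fin n → ℝ) (b : Fin m → ℝ) : Set (Fin n → ℝ) :=
  {x | ∀ i, b i ≤ a i ⬝ᵥ x}

/-- Optimal-solution set `X*(c) = argmin {c·x : A x ≥ b}`. -/
def OptSet {n m : ℕ} (a : Fin m → Fin n → ℝ) (b : Fin m → ℝ) (c : Fin n → ℝ) :
    Set (Fin n → ℝ) :=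
  {x ∈ Feas a b | ∀ y ∈ Feas a b, c ⬝ᵥ x ≤ c ⬝ᵥ y}

/-- Worst-case distance `W(g,c)` of a cluster assignment `g` and cost vectors `c`. -/
noncomputable def WDist {n K L : ℕ} {m : Fin K → ℕ} (N : Seminorm ℝ (Fin n → ℝ))
    (a : (k : Fin K) → Fin (m k) → Fin n → ℝ) (b : (k : Fin K) → Fin (m k) → ℝ)
    (xhat : Fin K → Fin n → ℝ) (g : Fin K → Fin L) (c : Fin L → Fin n → ℝ) : ℝ :=
  ⨆ k : Fin K, sSup ((fun x => N (xhat k - x)) '' OptSet (a k) (b k) (c (g k)))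

/-- The stability-driven clustering (SC) optimal value `ρ*`. -/
noncomputable def SCval {n : ℕ} (K L : ℕ) {m : Fin K → ℕ} (N : Seminorm ℝ (Fin n → ℝ))
    (a : (k : Fin K) → Fin (m k) → Fin n → ℝ) (b : (k : Fin K) → Fin (m k) → ℝ)
    (xhat : Fin K → Fin n → ℝ) : ℝ :=
  sInf {r : ℝ | ∃ (g : Fin K → Fin L) (c : Fin L → Fin n → ℝ),
    (∀ ℓ, ∑ j, |c ℓ j| = 1) ∧ r = WDist N a b xhat g c}

/-- The set of objective values of SC-LB-feasible tuples: a cluster assignment `g`,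
`ℓ1`-normalized cost vectors `c`, and for each `k` a feasible point `x^k`, an index set `I^k`
of `n` constraints tight at `x^k`, and nonnegative coefficients `λ^k` expressing `c^{g(k)}` as a
conic combination of the selected rows; the objective is `max_k ‖x̂^k − x^k‖`. -/
noncomputable def SCLBobjSet {n : ℕ} (K L : ℕ) {m : Fin K → ℕ} (N : Seminorm ℝ (Fin n → ℝ))
    (a : (k : Fin K) → Fin (m k) → Fin n → ℝ) (b : (k : Fin K) → Fin (m k) → ℝ)
    (xhat : Fin K → Fin n → ℝ) : Set ℝ :=
  {r : ℝ | ∃ (g : Fin K → Fin L) (c : Fin L → Fin n → ℝ)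
      (x : (k : Fin K) → Fin n → ℝ) (I : (k : Fin K) → Finset (Fin (m k)))
      (lam : (k : Fin K) → Fin (m k) → ℝ),
    (∀ ℓ, ∑ j, |c ℓ j| = 1) ∧
    (∀ k, x k ∈ Feas (a k) (b k)) ∧
    (∀ k, (I k).card = n) ∧
    (∀ k, ∀ i ∈ I k, a k i ⬝ᵥ x k = b k i) ∧
    (∀ k, ∀ i ∈ I k, 0 ≤ lam k i) ∧
    (∀ k, c (g k) = ∑ i ∈ I k, lam k i • a k i) ∧
    r = ⨆ k : Fin K, N (xhat k - x k)}

/-- The SC-LB value `β*`. -/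
noncomputable def SCLBval {n : ℕ} (K L : ℕ) {m : Fin K → ℕ} (N : Seminorm ℝ (Fin n → ℝ))
    (a : (k : Fin K) → Fin (m k) → Fin n → ℝ) (b : (k : Fin K) → Fin (m k) → ℝ)
    (xhat : Fin K → Fin n → ℝ) : ℝ :=
  sInf (SCLBobjSet K L N a b xhat)

lemma aux_carath {ι E : Type*} [AddCommGroup E] [Module ℝ E] [DecidableEq ι] (v : ι → E) (c : E) :
    ∀ (N : ℕ) (T : Finset ι), T.card = N → ∀ lam : ι → ℝ, (∀ i ∈ T, 0 ≤ lam i) →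
      c = ∑ i ∈ T, lam i • v i →
      ∃ J ⊆ T, LinearIndepOn ℝ v (J : Set ι) ∧ ∃ mu : ι → ℝ, (∀ i ∈ J, 0 ≤ mu i) ∧
        c = ∑ i ∈ J, mu i • v i := by
  intro N
  induction N with
  | zero =>
    intro T hT lam hl hc
    have : T = ∅ := Finset.card_eq_zero.mp hT
    subst this
    exact ⟨∅, by simp, by simp, lam, hl, hc⟩
  | succ N ih =>
    intro T hT lam hl hc
    by_cases hli : LinearIndepOn ℝ v (T : Set ι)
    · exact ⟨T, subset_rfl, hli, lam, hl, hc⟩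
    have key : ∃ t : ι → ℝ, ∑ i ∈ T, t i • v i = 0 ∧ ∃ i ∈ T, 0 < t i := by
      obtain ⟨f, hf, i, hi, hfi⟩ := not_linearIndepOn_finset_iff.mp hli
      rcases lt_or_gt_of_ne hfi with h | h
      · refine ⟨fun i => - f i, ?_, i, hi, by linarith⟩
        simp [neg_smul, hf]
      · exact ⟨f, hf, i, hi, h⟩
    obtain ⟨t, ht, i1, hi1, hti1⟩ := key
    obtain ⟨i0, hi0, hmin⟩ := (T.filter (fun i => 0 < t i)).exists_min_image
      (fun i => lam i / t i) ⟨i1, by simp [hi1, hti1]⟩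
    simp only [Finset.mem_filter] at hi0 hmin
    obtain ⟨hi0, hti0⟩ := hi0
    set r := lam i0 / t i0 with hr
    have hr0 : 0 ≤ r := div_nonneg (hl _ hi0) hti0.le
    have hz : lam i0 - r * t i0 = 0 := by rw [hr]; field_simp; ring
    obtain ⟨J, hJ, h1, h2⟩ := ih (T.erase i0) (by rw [Finset.card_erase_of_mem hi0, hT]; rfl)
      (fun i => lam i - r * t i) (by
        intro i hi
        have hiT := Finset.mem_of_mem_erase hi
        have := hl i hiT
        show 0 ≤ lam i - r * t i
        rcases le_or_gt (t i) 0 with h | h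
        · nlinarith
        · have := hmin i ⟨hiT, h⟩
          rw [le_div_iff₀ h] at this
          linarith) (by
        have h3 : ∑ i ∈ T, (lam i - r * t i) • v i = c := by
          simp only [sub_smul, Finset.sum_sub_distrib, mul_smul, ← Finset.smul_sum, ht, ← hc]
          simp
        rw [← h3, ← Finset.add_sum_erase T _ hi0, hz]; simp)
    exact ⟨J, hJ.trans (Finset.erase_subset _ _), h1, h2⟩

/-- finitely generated cone -/
def auxCone {ι : Type*} {n : ℕ} (v : ι → Fin n → ℝ) (T : Finset ι) : Set (Fin n → ℝ) :=
  {c | ∃ mu : ι → ℝ, (∀ i ∈ T, 0 ≤ mu i) ∧ c = ∑ i ∈ T, mu i • v i}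

lemma auxCone_closed_li {ι : Type*} {n : ℕ} (v : ι → Fin n → ℝ) (T : Finset ι)
    (h : LinearIndepOn ℝ v (T : Set ι)) : IsClosed (auxCone v T) := by
  classical
  have hli : LinearIndependent ℝ (fun i : T => v i) := h
  have hinj : LinearMap.ker (Fintype.linearCombination ℝ (fun i : T => v i)) = ⊥ :=
    LinearMap.ker_eq_bot.mpr hli.fintypeLinearCombination_injective
  have hce := LinearMap.isClosedEmbedding_of_injective hinj
  have hc : IsClosed {x : T → ℝ | ∀ i, 0 ≤ x i} := by
    simp only [Set.setOf_forall]
    exact isClosed_iInter fun i => isClosed_le continuous_const (continuous_apply i)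
  convert hce.isClosedMap _ hc using 1
  ext c
  simp only [auxCone, Set.mem_setOf_eq, Set.mem_image, Fintype.linearCombination_apply]
  constructor
  · rintro ⟨mu, h1, rfl⟩
    exact ⟨fun i => mu i, fun i => h1 i i.2, Finset.sum_coe_sort T (fun i => mu i • v i)⟩
  · rintro ⟨x, h1, rfl⟩
    refine ⟨fun i => if hi : i ∈ T then x ⟨i, hi⟩ else 0, ?_, ?_⟩
    · intro i hi; simpa [hi] using h1 ⟨i, hi⟩
    · rw [← Finset.sum_coe_sort T]
      exact Finset.sum_congr rfl fun i _ => by simp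

lemma auxCone_closed {ι : Type*} {n : ℕ} (v : ι → Fin n → ℝ) (T : Finset ι) :
    IsClosed (auxCone v T) := by
  classical
  have : auxCone v T = ⋃ J ∈ {J : Finset ι | J ⊆ T ∧ LinearIndepOn ℝ v (J : Set ι)},
      auxCone v J := by
    ext c
    simp only [Set.mem_iUnion, Set.mem_setOf_eq, exists_prop]
    constructor
    · rintro ⟨mu, h1, h2⟩
      obtain ⟨J, hJ, hl, h3⟩ := aux_carath v c _ T rfl mu h1 h2
      exact ⟨J, ⟨hJ, hl⟩, h3⟩
    · rintro ⟨J, ⟨hJ, _⟩, mu, h1, h2⟩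
      refine ⟨fun i => if i ∈ J then mu i else 0, ?_, ?_⟩
      · intro i _
        show 0 ≤ if i ∈ J then mu i else 0
        split_ifs with h
        · exact h1 i h
        · exact le_rfl
      · rw [h2, ← Finset.sum_subset hJ]
        · exact Finset.sum_congr rfl fun i hi => by simp [hi]
        · intro i _ hi; simp [hi]
  rw [this]
  refine Set.Finite.isClosed_biUnion ?_ fun J hJ => auxCone_closed_li v J hJ.2
  exact (T.powerset.finite_toSet).subset fun J hJ => by simpa using hJ.1

lemma aux_dual {n : ℕ} (f : (Fin n → ℝ) →ₗ[ℝ] ℝ) : ∃ d : Fin n → ℝ, ∀ y, f y = y ⬝ᵥ d := by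
  refine ⟨fun j => f (Pi.single j 1), fun y => ?_⟩
  conv_lhs => rw [pi_eq_sum_univ' y]
  simp only [map_sum, map_smul, smul_eq_mul, dotProduct]
  try exact Finset.sum_congr rfl fun i _ => by congr 2; ext j; simp [Pi.single_apply, eq_comm]

lemma aux_farkas {ι : Type*} {n : ℕ} (v : ι → Fin n → ℝ) (T : Finset ι) (c : Fin n → ℝ)
    (h : ∀ d, (∀ i ∈ T, 0 ≤ v i ⬝ᵥ d) → 0 ≤ c ⬝ᵥ d) : c ∈ auxCone v T := by
  classical
  by_contra hc
  let P : ProperCone ℝ (Fin n → ℝ) :=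
    { carrier := auxCone v T
      add_mem' := by
        rintro x y ⟨m1, h1, rfl⟩ ⟨m2, h2, rfl⟩
        exact ⟨fun i => m1 i + m2 i, fun i hi => add_nonneg (h1 i hi) (h2 i hi), by
          simp [add_smul, Finset.sum_add_distrib]⟩
      zero_mem' := ⟨fun _ => 0, by simp, by simp⟩
      smul_mem' := by
        rintro ⟨r, hr⟩ x ⟨m1, h1, rfl⟩
        refine ⟨fun i => r * m1 i, fun i hi => mul_nonneg hr (h1 i hi), ?_⟩
        simp only [mul_smul, ← Finset.smul_sum]
        rfl
      isClosed' := auxCone_closed v T }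
  obtain ⟨f, hf, hf0⟩ := P.hyperplane_separation_point (x₀ := c) hc
  obtain ⟨d, hd⟩ := aux_dual f.toLinearMap
  have hd' : ∀ y, f y = y ⬝ᵥ d := hd
  have := h d (fun i hi => by
    rw [← hd']
    refine hf _ ?_
    refine ⟨fun j => if j = i then 1 else 0, fun j _ => ?_, ?_⟩
    · show (0:ℝ) ≤ if j = i then 1 else 0
      split_ifs <;> norm_num
    · simp [hi])
  rw [← hd'] at this
  linarith

lemma aux_move {n m : ℕ} (a : Fin m → Fin n → ℝ) (b : Fin m → ℝ) (x d : Fin n → ℝ)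
    (hx : x ∈ Feas a b) (hd : ∀ i, a i ⬝ᵥ x = b i → 0 ≤ a i ⬝ᵥ d) :
    ∀ᶠ t : ℝ in nhdsWithin 0 (Set.Ioi 0), x + t • d ∈ Feas a b := by
  simp only [Feas, Set.mem_setOf_eq, dotProduct_add, dotProduct_smul, smul_eq_mul]
  rw [Filter.eventually_all]
  intro i
  rcases (hx i).eq_or_lt with h | h
  · filter_upwards [self_mem_nhdsWithin] with t ht
    have := mul_nonneg (le_of_lt ht) (hd i h.symm)
    linarith
  · have hc : Continuous fun t : ℝ => a i ⬝ᵥ x + t * a i ⬝ᵥ d := by fun_prop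
    have := (hc.tendsto 0).eventually (lt_mem_nhds (a := b i) (by simpa using h))
    exact (this.filter_mono nhdsWithin_le_nhds).mono fun t ht => ht.le

lemma aux_basis {n m : ℕ} (a : Fin m → Fin n → ℝ) (b : Fin m → ℝ) (c : Fin n → ℝ)
    (hne : (Feas a b).Nonempty) (hb : Bornology.IsBounded (Feas a b)) :
    ∃ (x : Fin n → ℝ) (I : Finset (Fin m)) (lam : Fin m → ℝ), x ∈ OptSet a b c ∧ I.card = n ∧
      (∀ i ∈ I, a i ⬝ᵥ x = b i) ∧ (∀ i ∈ I, 0 ≤ lam i) ∧ c = ∑ i ∈ I, lam i • a i := by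
  classical
  have hcl : IsClosed (Feas a b) := by
    simp only [Feas, Set.setOf_forall]
    exact isClosed_iInter fun i => isClosed_le continuous_const (by fun_prop)
  have hcomp : IsCompact (Feas a b) := Metric.isCompact_of_isClosed_isBounded hcl hb
  have hcc : Continuous fun x : Fin n → ℝ => c ⬝ᵥ x := by fun_prop
  obtain ⟨x0, hx0, hmin⟩ := hcomp.exists_isMinOn hne hcc.continuousOn
  have hone : (OptSet a b c).Nonempty := ⟨x0, hx0, fun y hy => hmin hy⟩
  have hocl : IsCompact (OptSet a b c) := by
    have : OptSet a b c = Feas a b ∩ {x | c ⬝ᵥ x ≤ c ⬝ᵥ x0} := by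
      ext x
      refine ⟨fun h => ⟨h.1, h.2 x0 hx0⟩, fun h => ⟨h.1, fun y hy => le_trans h.2 (hmin hy)⟩⟩
    rw [this]
    exact hcomp.inter_right (isClosed_le hcc continuous_const)
  obtain ⟨x, hx⟩ := hocl.extremePoints_nonempty hone
  have hxo : x ∈ OptSet a b c := hx.1
  set T : Finset (Fin m) := Finset.univ.filter fun i => a i ⬝ᵥ x = b i with hT
  have hspan : Submodule.span ℝ (a '' (T : Set (Fin m))) = ⊤ := by
    by_contra hs
    obtain ⟨f, hf0, hf⟩ := Submodule.exists_le_ker_of_lt_top _ (lt_top_iff_ne_top.mpr hs)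
    obtain ⟨d, hd⟩ := aux_dual f
    have hd0 : ∀ i, a i ⬝ᵥ x = b i → a i ⬝ᵥ d = 0 := by
      intro i hi
      rw [← hd]
      exact hf (Submodule.subset_span ⟨i, by simp [hT, hi], rfl⟩)
    have e1 := aux_move a b x d hxo.1 fun i hi => (hd0 i hi).ge
    have e2 := aux_move a b x (-d) hxo.1 fun i hi => by simp [hd0 i hi]
    obtain ⟨t, ⟨h1, h2⟩, ht⟩ := ((e1.and e2).and self_mem_nhdsWithin).exists
    have ht : 0 < t := ht
    have k1 := hxo.2 _ h1
    have k2 := hxo.2 _ h2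
    simp only [dotProduct_add, dotProduct_smul, smul_eq_mul, dotProduct_neg] at k1 k2
    have k3 : t * c ⬝ᵥ d = 0 := by linarith
    have o1 : x + t • d ∈ OptSet a b c := ⟨h1, fun y hy => by
      have := hxo.2 y hy
      simp only [dotProduct_add, dotProduct_smul, smul_eq_mul]; linarith⟩
    have o2 : x + t • (-d) ∈ OptSet a b c := ⟨h2, fun y hy => by
      have := hxo.2 y hy
      simp only [dotProduct_add, dotProduct_smul, smul_eq_mul, dotProduct_neg]; linarith⟩
    have := (mem_extremePoints.mp hx).2 _ o1 _ o2
      ⟨1/2, 1/2, by norm_num, by norm_num, by norm_num, by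
        ext j; simp only [Pi.add_apply, Pi.smul_apply, Pi.neg_apply, smul_eq_mul]; ring⟩
    have hdz : d = 0 := by
      have h3 : t • d = 0 := by simpa using this.1
      exact (smul_eq_zero.mp h3).resolve_left ht.ne'
    apply hf0
    ext y
    simp [hd, hdz]
  have hcone : c ∈ auxCone a T := by
    apply aux_farkas
    intro d hd
    have e1 := aux_move a b x d hxo.1 fun i hi => hd i (by simp [hT, hi])
    obtain ⟨t, h1, ht⟩ := (e1.and self_mem_nhdsWithin).exists
    have ht : 0 < t := ht
    have k1 := hxo.2 _ h1
    simp only [dotProduct_add, dotProduct_smul, smul_eq_mul] at k1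
    by_contra hneg
    push Not at hneg
    nlinarith
  obtain ⟨mu0, hm0, hc0⟩ := hcone
  obtain ⟨J, hJT, hJ, mu, hmu, hc⟩ := aux_carath a c _ T rfl mu0 hm0 hc0
  obtain ⟨B, hBT, hJB, hTB, hB⟩ := exists_linearIndepOn_extension hJ
    (show (J : Set (Fin m)) ⊆ T from by exact_mod_cast hJT)
  have hBspan : Submodule.span ℝ (a '' B) = ⊤ := by
    rw [eq_top_iff, ← hspan]
    exact Submodule.span_le.mpr hTB
  have hcard : B.toFinset.card = n := by
    have hli : LinearIndependent ℝ (fun i : B => a i) := hB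
    have := Module.finrank_eq_card_basis (Module.Basis.mk hli (by
      rw [← hBspan, Set.image_eq_range]))
    rw [Module.finrank_fin_fun] at this
    rw [Set.toFinset_card, this]
  refine ⟨x, B.toFinset, fun i => if i ∈ J then mu i else 0, hxo, hcard, ?_, ?_, ?_⟩
  · intro i hi
    have : i ∈ T := by exact_mod_cast hBT (Set.mem_toFinset.mp hi)
    simpa [hT] using this
  · intro i _
    show 0 ≤ if i ∈ J then mu i else 0
    split_ifs with h
    · exact hmu i h
    · exact le_rfl
  · have hJB' : J ⊆ B.toFinset := fun i hi => Set.mem_toFinset.mpr (hJB (by exact_mod_cast hi))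
    rw [hc, ← Finset.sum_subset hJB']
    · exact Finset.sum_congr rfl fun i hi => by simp [hi]
    · intro i _ hi; simp [hi]

lemma aux_unique {n m : ℕ} (a : Fin m → Fin n → ℝ) (b : Fin m → ℝ) (c x : Fin n → ℝ)
    (I : Finset (Fin m)) (lam : Fin m → ℝ) (hx : x ∈ Feas a b) (hI : I.card = n)
    (ht : ∀ i ∈ I, a i ⬝ᵥ x = b i) (hl : ∀ i ∈ I, 0 < lam i) (hc : c = ∑ i ∈ I, lam i • a i)
    (hli : LinearIndependent ℝ (fun i : I => a i)) : OptSet a b c = {x} := by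
  classical
  have hdot : ∀ y, c ⬝ᵥ y = ∑ i ∈ I, lam i * a i ⬝ᵥ y := by
    intro y; rw [hc, sum_dotProduct]; simp [smul_dotProduct]
  have hopt : x ∈ OptSet a b c := by
    refine ⟨hx, fun y hy => ?_⟩
    rw [hdot, hdot]
    refine Finset.sum_le_sum fun i hi => mul_le_mul_of_nonneg_left ?_ (hl i hi).le
    rw [ht i hi]; exact hy i
  ext y
  refine ⟨fun hy => ?_, fun hy => by rw [Set.mem_singleton_iff.mp hy]; exact hopt⟩
  have heq : c ⬝ᵥ x = c ⬝ᵥ y := le_antisymm (hopt.2 y hy.1) (hy.2 x hx)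
  rw [hdot, hdot] at heq
  have hle : ∀ i ∈ I, lam i * a i ⬝ᵥ x ≤ lam i * a i ⬝ᵥ y := fun i hi =>
    mul_le_mul_of_nonneg_left (by rw [ht i hi]; exact hy.1 i) (hl i hi).le
  have h1 := (Finset.sum_eq_sum_iff_of_le hle).mp heq
  have h2 : ∀ i ∈ I, a i ⬝ᵥ (y - x) = 0 := fun i hi => by
    have := mul_left_cancel₀ (hl i hi).ne' (h1 i hi)
    rw [dotProduct_sub]; linarith
  have hspan : Submodule.span ℝ (Set.range fun i : I => a i) = ⊤ :=
    hli.span_eq_top_of_card_eq_finrank' (by simp [hI])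
  have h3 : ∀ w : Fin n → ℝ, w ⬝ᵥ (y - x) = 0 := by
    intro w
    have hw : w ∈ Submodule.span ℝ (Set.range fun i : I => a i) := by rw [hspan]; trivial
    induction hw using Submodule.span_induction with
    | mem w h => obtain ⟨i, rfl⟩ := h; exact h2 i i.2
    | zero => simp
    | add u v _ _ hu hv => rw [add_dotProduct, hu, hv, add_zero]
    | smul r u _ hu => rw [smul_dotProduct, hu, smul_zero]
  have := dotProduct_self_eq_zero.mp (h3 (y - x))
  exact sub_eq_zero.mp this

lemma aux_bdd {n : ℕ} (N : Seminorm ℝ (Fin n → ℝ)) (z : Fin n → ℝ) (S : Set (Fin n → ℝ))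
    (hS : Bornology.IsBounded S) : BddAbove ((fun x => N (z - x)) '' S) := by
  have hc : Continuous N := by
    have := ConvexOn.continuousOn isOpen_univ N.convexOn
    exact continuousOn_univ.mp this
  have hc2 : Continuous fun x => N (z - x) := hc.comp (by fun_prop)
  have hk : IsCompact (closure S) := hS.isCompact_closure
  exact (hk.bddAbove_image hc2.continuousOn).mono (Set.image_mono subset_closure)

/-- **Proposition 2(ii).** If the SC-LB value `β*` is attained by a feasible tuple whose conic
coefficients are strictly positive on the selected index sets and whose selected rows are
linearly independent (the nondegeneracy implicit in the paper's proof), then `β* = ρ*`. -/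
theorem sclb_eq_sc_of_strict
    (n K L : ℕ) (hn : 1 ≤ n) (hK : 1 ≤ K) (hL : 1 ≤ L)
    (N : Seminorm ℝ (Fin n → ℝ)) (hN : ∀ x, N x = 0 → x = 0)
    (m : Fin K → ℕ)
    (a : (k : Fin K) → Fin (m k) → Fin n → ℝ) (b : (k : Fin K) → Fin (m k) → ℝ)
    (hne : ∀ k, (Feas (a k) (b k)).Nonempty)
    (hbdd : ∀ k, Bornology.IsBounded (Feas (a k) (b k)))
    (xhat : Fin K → Fin n → ℝ)
    (hattain : ∃ (g : Fin K → Fin L) (c : Fin L → Fin n → ℝ)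
        (x : (k : Fin K) → Fin n → ℝ) (I : (k : Fin K) → Finset (Fin (m k)))
        (lam : (k : Fin K) → Fin (m k) → ℝ),
      (∀ ℓ, ∑ j, |c ℓ j| = 1) ∧
      (∀ k, x k ∈ Feas (a k) (b k)) ∧
      (∀ k, (I k).card = n) ∧
      (∀ k, ∀ i ∈ I k, a k i ⬝ᵥ x k = b k i) ∧
      (∀ k, ∀ i ∈ I k, 0 < lam k i) ∧
      (∀ k, c (g k) = ∑ i ∈ I k, lam k i • a k i) ∧
      (∀ k, LinearIndependent ℝ (fun i : (I k : Finset (Fin (m k))) => a k i)) ∧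
      (⨆ k : Fin K, N (xhat k - x k)) = SCLBval K L N a b xhat) :
    SCLBval K L N a b xhat = SCval K L N a b xhat := by
  classical
  haveI : Nonempty (Fin K) := ⟨⟨0, hK⟩⟩
  obtain ⟨g, c, x, I, lam, h1, h2, h3, h4, h5, h6, h7, h8⟩ := hattain
  have hW : WDist N a b xhat g c = SCLBval K L N a b xhat := by
    rw [← h8, WDist]
    congr 1
    ext k
    rw [aux_unique (a k) (b k) (c (g k)) (x k) (I k) (lam k) (h2 k) (h3 k) (h4 k) (h5 k) (h6 k)
      (h7 k)]
    simp
  apply le_antisymm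
  · unfold SCval
    refine le_csInf ⟨_, g, c, h1, rfl⟩ ?_
    rintro r ⟨g', c', hc', rfl⟩
    choose y J mu hy hJ hty hmu hcy using
      fun k => aux_basis (a k) (b k) (c' (g' k)) (hne k) (hbdd k)
    have hmem : (⨆ k : Fin K, N (xhat k - y k)) ∈ SCLBobjSet K L N a b xhat :=
      ⟨g', c', y, J, mu, hc', fun k => (hy k).1, hJ, hty, hmu, hcy, rfl⟩
    have hbelow : BddBelow (SCLBobjSet K L N a b xhat) := by
      refine ⟨0, ?_⟩
      rintro r ⟨_, _, _, _, _, _, _, _, _, _, _, rfl⟩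
      exact Real.iSup_nonneg fun k => apply_nonneg N _
    refine (csInf_le hbelow hmem).trans ?_
    refine ciSup_mono (Set.finite_range _).bddAbove fun k => ?_
    exact le_csSup (aux_bdd N _ _ ((hbdd k).subset fun z hz => hz.1)) ⟨y k, hy k, rfl⟩
  · rw [← hW]
    refine csInf_le ⟨0, ?_⟩ ⟨g, c, h1, rfl⟩
    rintro r ⟨g', c', _, rfl⟩
    refine Real.iSup_nonneg fun k => Real.sSup_nonneg ?_
    rintro _ ⟨z, _, rfl⟩
    exact apply_nonneg N _
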